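/- arXiv:1802.02325 — 6 statements merged into one kernel-verified Lean document; each statement's English description precedes it below -/
import Mathlib

section
/- Let b, ℓ be positive integers and let q_1, …, q_b be distinct primes, each greater than ℓ. For x ∈ {0,1}^{b·ℓ}, partition x into ℓ blocks x¹, …, x^ℓ ∈ {0,1}^b (where x^i_j denotes the j-th bit of the i-th block), and define ψ(x) ∈ ℤ^ℓ by letting ψ(x)_i be the unique integer with 0 ≤ ψ(x)_i < ∏_{j=1}^b q_j and ψ(x)_i ≡ x^i_j (mod q_j) for every j ∈ [b]. Then for all x, y ∈ {0,1}^{b·ℓ} and every j ∈ [b], ψ(x)·ψ(y) ≡ ∑_{i=1}^ℓ x^i_j · y^i_j (mod q_j); and consequently x·y = 0 if and only if q_j divides ψ(x)·ψ(y) for every j ∈ [b]. -/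
/-- Chinese-remainder encoding of Boolean vectors, block by block:
if `q 1, …, q b` are distinct primes all exceeding `ℓ`, `x, y ∈ {0,1}^{b·ℓ}` are
partitioned into `ℓ` blocks of length `b` (`x i j` is the `j`-th bit of the `i`-th block),
and `ψx i` (resp. `ψy i`) is the unique integer in `[0, ∏ j, q j)` that is congruent to
`x i j` mod `q j` for every `j`, then for every `j` the inner product `ψx · ψy` is
congruent mod `q j` to `∑ i, x i j * y i j`; consequently `x · y = 0` iff `q j` divides
`ψx · ψy` for every `j`. -/
theorem crt_block_encoding_inner_product
    (b ℓ : ℕ) (hb : 0 < b) (hℓ : 0 < ℓ)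
    (q : Fin b → ℕ) (hq : ∀ j, (q j).Prime) (hqℓ : ∀ j, ℓ < q j)
    (hqinj : Function.Injective q)
    (x y : Fin ℓ → Fin b → Bool)
    (ψx ψy : Fin ℓ → ℤ)
    (hψx0 : ∀ i, 0 ≤ ψx i) (hψx1 : ∀ i, ψx i < ∏ j, (q j : ℤ))
    (hψxc : ∀ i j, ψx i ≡ ((x i j).toNat : ℤ) [ZMOD (q j : ℤ)])
    (hψy0 : ∀ i, 0 ≤ ψy i) (hψy1 : ∀ i, ψy i < ∏ j, (q j : ℤ))
    (hψyc : ∀ i j, ψy i ≡ ((y i j).toNat : ℤ) [ZMOD (q j : ℤ)]) :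
    (∀ j, (∑ i, ψx i * ψy i) ≡
        (∑ i, ((x i j).toNat : ℤ) * ((y i j).toNat : ℤ)) [ZMOD (q j : ℤ)]) ∧
    ((∑ i, ∑ j, ((x i j).toNat : ℤ) * ((y i j).toNat : ℤ)) = 0 ↔
      ∀ j, (q j : ℤ) ∣ ∑ i, ψx i * ψy i) := by
  have h1 : ∀ j, (∑ i, ψx i * ψy i) ≡
        (∑ i, ((x i j).toNat : ℤ) * ((y i j).toNat : ℤ)) [ZMOD (q j : ℤ)] := by
    intro j
    rw [Int.modEq_iff_dvd, ← Finset.sum_sub_distrib]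
    apply Finset.dvd_sum
    intro i _
    exact Int.modEq_iff_dvd.mp ((hψxc i j).mul (hψyc i j))
  have hnn : ∀ i j, (0 : ℤ) ≤ ((x i j).toNat : ℤ) * ((y i j).toNat : ℤ) := by
    intro i j
    positivity
  have hle : ∀ i j, ((x i j).toNat : ℤ) * ((y i j).toNat : ℤ) ≤ 1 := by
    intro i j
    cases x i j <;> cases y i j <;> simp
  refine ⟨h1, ?_⟩
  rw [Finset.sum_comm, Finset.sum_eq_zero_iff_of_nonneg
    (fun j _ => Finset.sum_nonneg (fun i _ => hnn i j))]
  constructor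
  · intro h j
    have h2 := h1 j
    rw [h j (Finset.mem_univ j)] at h2
    exact Int.modEq_zero_iff_dvd.mp h2
  · intro h j _
    have h2 : (q j : ℤ) ∣ ∑ i, ((x i j).toNat : ℤ) * ((y i j).toNat : ℤ) :=
      Int.modEq_zero_iff_dvd.mp ((h1 j).symm.trans (Int.modEq_zero_iff_dvd.mpr (h j)))
    refine Int.eq_zero_of_dvd_of_nonneg_of_lt (Finset.sum_nonneg (fun i _ => hnn i j)) ?_ h2
    calc ∑ i, ((x i j).toNat : ℤ) * ((y i j).toNat : ℤ) ≤ ∑ _i : Fin ℓ, (1 : ℤ) :=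
          Finset.sum_le_sum (fun i _ => hle i j)
      _ = (ℓ : ℤ) := by simp
      _ < (q j : ℤ) := by exact_mod_cast hqℓ j
end

section
/- Let b, ℓ be positive integers and let q_1, …, q_b be distinct primes, each greater than ℓ. For x ∈ {0,1}^{b·ℓ}, partition x into ℓ blocks x¹, …, x^ℓ ∈ {0,1}^b (where x^i_j denotes the j-th bit of the i-th block), and define ψ(x) ∈ ℤ^ℓ by letting ψ(x)_i be the unique integer with 0 ≤ ψ(x)_i < ∏_{j=1}^b q_j and ψ(x)_i ≡ x^i_j (mod q_j) for every j ∈ [b]. Then for all x, y ∈ {0,1}^{b·ℓ}, the exact inner product is recovered as x·y = ∑_{j=1}^b ((ψ(x)·ψ(y)) mod q_j), where (t mod q) denotes the unique representative of t modulo q in [0, q). -/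
/-- With the Chinese-remainder block encoding `ψ` of Boolean vectors
(`q 1, …, q b` distinct primes exceeding `ℓ`, `x i j` the `j`-th bit of the `i`-th of `ℓ`
blocks of length `b`, and `ψx i` the unique integer in `[0, ∏ j, q j)` congruent to
`x i j` mod `q j` for every `j`), the exact inner product is recovered as
`x · y = ∑ j, ((ψx · ψy) mod q j)`, where `mod` takes the representative in `[0, q j)`. -/
theorem crt_block_encoding_recovers_exact_inner_product
    (b ℓ : ℕ) (hb : 0 < b) (hℓ : 0 < ℓ)
    (q : Fin b → ℕ) (hq : ∀ j, (q j).Prime) (hqℓ : ∀ j, ℓ < q j)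
    (hqinj : Function.Injective q)
    (x y : Fin ℓ → Fin b → Bool)
    (ψx ψy : Fin ℓ → ℤ)
    (hψx0 : ∀ i, 0 ≤ ψx i) (hψx1 : ∀ i, ψx i < ∏ j, (q j : ℤ))
    (hψxc : ∀ i j, ψx i ≡ ((x i j).toNat : ℤ) [ZMOD (q j : ℤ)])
    (hψy0 : ∀ i, 0 ≤ ψy i) (hψy1 : ∀ i, ψy i < ∏ j, (q j : ℤ))
    (hψyc : ∀ i j, ψy i ≡ ((y i j).toNat : ℤ) [ZMOD (q j : ℤ)]) :
    (∑ i, ∑ j, ((x i j).toNat : ℤ) * ((y i j).toNat : ℤ)) =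
      ∑ j, (∑ i, ψx i * ψy i) % (q j : ℤ) := by
  rw [Finset.sum_comm]
  refine Finset.sum_congr rfl fun j _ => ?_
  have hc : (∑ i, ψx i * ψy i) ≡ ∑ i, ((x i j).toNat : ℤ) * ((y i j).toNat : ℤ)
      [ZMOD (q j : ℤ)] := by
    rw [Int.modEq_iff_dvd, ← Finset.sum_sub_distrib]
    exact Finset.dvd_sum fun i _ => ((hψxc i j).mul (hψyc i j)).dvd
  have h0 : 0 ≤ ∑ i, ((x i j).toNat : ℤ) * ((y i j).toNat : ℤ) :=
    Finset.sum_nonneg fun i _ => by positivity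
  have h1 : ∑ i, ((x i j).toNat : ℤ) * ((y i j).toNat : ℤ) ≤ ∑ _i : Fin ℓ, (1 : ℤ) :=
    Finset.sum_le_sum fun i _ => by cases x i j <;> cases y i j <;> simp
  have h2 : (ℓ : ℤ) < q j := by exact_mod_cast hqℓ j
  simp only [Finset.sum_const, Finset.card_univ, Fintype.card_fin, nsmul_eq_mul, mul_one] at h1
  rw [hc.eq, Int.emod_eq_of_lt h0 (lt_of_le_of_lt h1 h2)]
end

section
/- Suppose b, ℓ, b_micro, κ are positive integers with b and ℓ sufficiently large, b ≥ ℓ, b_micro dividing b, and ℓ^{κ·b_micro} = b. If there exists a (b_micro, ℓ, κ)-reduction, then there exists a (b, ℓ, 6κ)-reduction. -/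
/-- A `(b, ℓ, κ)`-reduction: a map `φ : {0,1}^{b·ℓ} → ℤ^ℓ` and a set `V ⊆ ℤ` such that
(i) `x · y = 0 ↔ φ(x) · φ(y) ∈ V` for all `x, y ∈ {0,1}^{b·ℓ}`, and
(ii) every coordinate of `φ(x)` lies in `[0, ℓ^{κ·b})`. -/
def IsReduction (b ℓ κ : ℕ) (φ : (Fin (b * ℓ) → Bool) → Fin ℓ → ℤ) (V : Set ℤ) : Prop :=
  (∀ x y : Fin (b * ℓ) → Bool,
      (∑ i, ((x i).toNat : ℤ) * ((y i).toNat : ℤ)) = 0 ↔ (∑ i, φ x i * φ y i) ∈ V) ∧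
  (∀ x : Fin (b * ℓ) → Bool, ∀ i, 0 ≤ φ x i ∧ φ x i < (ℓ : ℤ) ^ (κ * b))

theorem many_primes (b : ℕ) (hb : 3 ≤ b) :
    b ^ 3 + b < (Nat.primesLE (b ^ 6)).card := by
  by_contra hcon
  push Not at hcon
  have h1 := Chebyshev.two_pow_le_mul_lcmUpto (b ^ 6)
  rw [Nat.lcmUpto_eq_prod_pow_log] at h1
  have h2 : ∏ p ∈ Nat.primesLE (b ^ 6), p ^ p.log (b ^ 6)
      ≤ (b ^ 6) ^ (Nat.primesLE (b ^ 6)).card := by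
    apply Finset.prod_le_pow_card
    intro p _
    exact Nat.pow_log_le_self p (by positivity)
  have hlt : b ^ 6 ≤ 2 ^ (6 * b) := by
    rw [mul_comm, pow_mul]
    exact Nat.pow_le_pow_left (Nat.lt_two_pow_self).le 6
  have h3 : (b ^ 6) ^ (Nat.primesLE (b ^ 6)).card ≤ 2 ^ (6 * b * (b ^ 3 + b)) := by
    calc (b ^ 6) ^ (Nat.primesLE (b ^ 6)).card ≤ (b ^ 6) ^ (b ^ 3 + b) :=
          Nat.pow_le_pow_right (by positivity) hcon
      _ ≤ (2 ^ (6 * b)) ^ (b ^ 3 + b) := Nat.pow_le_pow_left hlt _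
      _ = _ := by rw [← pow_mul]
  have h4 : b ^ 6 + 1 ≤ 2 ^ (6 * b + 1) := by
    rw [pow_succ 2 (6 * b)]
    have : 1 ≤ 2 ^ (6 * b) := Nat.one_le_two_pow
    omega
  have h5 : 2 ^ (b ^ 6) ≤ 2 ^ (6 * b + 1 + 6 * b * (b ^ 3 + b)) := by
    rw [pow_add 2 (6 * b + 1)]
    exact h1.trans (Nat.mul_le_mul h4 (h2.trans h3))
  have h6 := (Nat.pow_le_pow_iff_right (by norm_num : 1 < 2)).1 h5
  obtain ⟨c, rfl⟩ := Nat.exists_eq_add_of_le hb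
  ring_nf at h6
  nlinarith [Nat.zero_le (c ^ 2), Nat.zero_le (c ^ 3), Nat.zero_le (c ^ 4), Nat.zero_le (c ^ 5),
    Nat.zero_le (c ^ 6)]

theorem exists_moduli (b B : ℕ) (hb : 3 ≤ b) (hB : B ≤ b) :
    ∃ q : Fin B → ℕ, Function.Injective q ∧
      ∀ j, (q j).Prime ∧ b ^ 3 ≤ q j ∧ q j ≤ b ^ 6 := by
  have h1 := many_primes b hb
  set S := (Nat.primesLE (b ^ 6)).filter (fun p => b ^ 3 ≤ p) with hS
  have h2 : (Nat.primesLE (b ^ 6)).card ≤ S.card + b ^ 3 := by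
    have hsub : Nat.primesLE (b ^ 6) ⊆ S ∪ Finset.range (b ^ 3) := by
      intro p hp
      by_cases h : b ^ 3 ≤ p
      · exact Finset.mem_union_left _ (Finset.mem_filter.2 ⟨hp, h⟩)
      · exact Finset.mem_union_right _ (Finset.mem_range.2 (by omega))
    calc _ ≤ _ := Finset.card_le_card hsub
      _ ≤ _ := Finset.card_union_le _ _
      _ = _ := by rw [Finset.card_range]
  have h3 : B ≤ S.card := by omega
  refine ⟨fun j => S.equivFin.symm (Fin.castLE h3 j), ?_, ?_⟩
  · intro i j hij
    exact Fin.castLE_injective h3 (S.equivFin.symm.injective (Subtype.ext hij))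
  · intro j
    have := (S.equivFin.symm (Fin.castLE h3 j)).2
    have := Finset.mem_filter.1 this
    rw [Nat.mem_primesLE] at this
    exact ⟨this.1.2, this.2, this.1.1⟩

theorem dot_eq_zero_iff {ι : Type*} [Fintype ι] (x y : ι → Bool) :
    (∑ i, ((x i).toNat : ℤ) * ((y i).toNat : ℤ)) = 0 ↔
      ∀ i, ((x i).toNat : ℤ) * ((y i).toNat : ℤ) = 0 := by
  rw [Finset.sum_eq_zero_iff_of_nonneg (fun i _ => by positivity)]
  simp

/-- For sufficiently large `b, ℓ` with `b ≥ ℓ`, `b_micro ∣ b` and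
`ℓ^{κ·b_micro} = b`: if there is a `(b_micro, ℓ, κ)`-reduction, then there is a
`(b, ℓ, 6κ)`-reduction. -/
theorem reduction_recursion_step :
    ∃ b₀ ℓ₀ : ℕ, ∀ b ℓ bmicro κ : ℕ,
      b₀ ≤ b → ℓ₀ ≤ ℓ → 0 < bmicro → 0 < κ →
      ℓ ≤ b → bmicro ∣ b → ℓ ^ (κ * bmicro) = b →
      (∃ (φ : (Fin (bmicro * ℓ) → Bool) → Fin ℓ → ℤ) (V : Set ℤ),
          IsReduction bmicro ℓ κ φ V) →
      ∃ (ψ : (Fin (b * ℓ) → Bool) → Fin ℓ → ℤ) (V : Set ℤ),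
          IsReduction b ℓ (6 * κ) ψ V := by
  refine ⟨3, 0, ?_⟩
  rintro b ℓ m κ hb - hm hκ hℓb ⟨B, hB⟩ hpow ⟨φ, V, hφ, hbd⟩
  have hBb : B ≤ b := by rw [hB]; exact Nat.le_mul_of_pos_left _ hm
  obtain ⟨q, hqinj, hq⟩ := exists_moduli b B hb hBb
  have e : Fin B × Fin (m * ℓ) ≃ Fin (b * ℓ) := Fintype.equivOfCardEq (by
    simp only [Fintype.card_prod, Fintype.card_fin]; rw [hB]; ring)
  -- the blocks
  let z : (Fin (b * ℓ) → Bool) → Fin B → Fin ℓ → ℤ := fun x j => φ (fun k => x (e (j, k)))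
  have hz0 : ∀ x j i, 0 ≤ z x j i := fun x j i => (hbd _ i).1
  have hzb : ∀ x j i, z x j i < b := fun x j i => by
    have := (hbd (fun k => x (e (j, k))) i).2
    rw [← hpow]; push_cast; exact this
  have hq0 : ∀ j ∈ (Finset.univ : Finset (Fin B)), q j ≠ 0 := fun j _ => (hq j).1.ne_zero
  have hco : Set.Pairwise ((Finset.univ : Finset (Fin B)) : Set (Fin B))
      (Function.onFun Nat.Coprime q) := by
    intro i _ j _ hij
    exact (Nat.coprime_primes (hq i).1 (hq j).1).2 (fun h => hij (hqinj h))
  let w : (Fin (b * ℓ) → Bool) → Fin ℓ → ℕ := fun x i =>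
    Nat.chineseRemainderOfFinset (fun j => (z x j i).toNat) q Finset.univ hq0 hco
  have hwz : ∀ x i j, (w x i : ℤ) ≡ z x j i [ZMOD (q j : ℤ)] := by
    intro x i j
    have := (Nat.chineseRemainderOfFinset (fun j => (z x j i).toNat) q
      Finset.univ hq0 hco).2 j (Finset.mem_univ j)
    have h2 := Int.natCast_modEq_iff.2 this
    rwa [Int.toNat_of_nonneg (hz0 x j i)] at h2
  have hwlt : ∀ x i, w x i < ∏ j, q j := fun x i =>
    Nat.chineseRemainderOfFinset_lt_prod _ q hq0 hco
  have key : ∀ x y j, (∑ i, (w x i : ℤ) * (w y i : ℤ)) % (q j : ℤ) = ∑ i, z x j i * z y j i := by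
    intro x y j
    have h1 : (∑ i, (w x i : ℤ) * (w y i : ℤ)) ≡ ∑ i, z x j i * z y j i [ZMOD (q j : ℤ)] :=
      Int.ModEq.sum (fun i _ => (hwz x i j).mul (hwz y i j))
    rw [h1]
    apply Int.emod_eq_of_lt
    · exact Finset.sum_nonneg (fun i _ => mul_nonneg (hz0 x j i) (hz0 y j i))
    · have hb0 : (0 : ℤ) < b := by exact_mod_cast (by omega : 0 < b)
      have h2 : ∑ i, z x j i * z y j i ≤ ∑ _i : Fin ℓ, ((b : ℤ) ^ 2 - 1) := by
        apply Finset.sum_le_sum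
        intro i _
        nlinarith [hz0 x j i, hz0 y j i, hzb x j i, hzb y j i]
      rw [Finset.sum_const, Finset.card_univ, Fintype.card_fin, nsmul_eq_mul] at h2
      have h3 : (b : ℤ) ^ 3 ≤ q j := by exact_mod_cast (hq j).2.1
      have h4 : (ℓ : ℤ) ≤ b := by exact_mod_cast hℓb
      have h5 : (3 : ℤ) ≤ b := by exact_mod_cast hb
      have h6 : (ℓ : ℤ) * ((b : ℤ) ^ 2 - 1) ≤ b * ((b : ℤ) ^ 2 - 1) :=
        mul_le_mul_of_nonneg_right h4 (by nlinarith)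
      nlinarith
  refine ⟨fun x i => (w x i : ℤ), {t | ∀ j, t % (q j : ℤ) ∈ V}, ?_, ?_⟩
  · intro x y
    simp only [Set.mem_ofPred_eq]
    rw [dot_eq_zero_iff]
    have hj : ∀ j, (∑ i, (w x i : ℤ) * (w y i : ℤ)) % (q j : ℤ) ∈ V ↔
        ∀ k, ((x (e (j, k))).toNat : ℤ) * ((y (e (j, k))).toNat : ℤ) = 0 := by
      intro j
      rw [key]
      exact (hφ _ _).symm.trans (dot_eq_zero_iff _ _)
    simp only [hj]
    constructor
    · intro h j k
      exact h _
    · intro h i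
      have := h (e.symm i).1 (e.symm i).2
      simpa using this
  · intro x i
    refine ⟨by positivity, ?_⟩
    have h1 : ∏ j, q j ≤ (b ^ 6) ^ B := by
      calc ∏ j, q j ≤ (b ^ 6) ^ (Finset.univ : Finset (Fin B)).card :=
            Finset.prod_le_pow_card _ _ _ (fun j _ => (hq j).2.2)
        _ = _ := by simp
    have h2 : (b ^ 6) ^ B = ℓ ^ (6 * κ * b) := by
      conv_lhs => rw [← hpow]
      rw [← pow_mul, ← pow_mul]
      congr 1
      conv_rhs => rw [hB]
      ring
    have h3 := (hwlt x i).trans_le (h1.trans_eq h2)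
    show (w x i : ℤ) < _
    exact_mod_cast h3
end

section
/- Let d be a positive integer, M ≥ 1 a real, and A, B nonempty finite sets of vectors in ℝ^d all of whose coordinates have absolute value at most M. Let W be a real with W ≥ 5·d·M². For x ∈ A define x̃ = (x, √(W − ‖x‖²), 0) ∈ ℝ^{d+2}, and for y ∈ B define ỹ = (−y, 0, √(W − ‖y‖²)) ∈ ℝ^{d+2}. Then: (i) for all x ∈ A, y ∈ B, ‖x̃ − ỹ‖² = 2W + 2·(x·y); (ii) for all x₁, x₂ ∈ A, ‖x̃₁ − x̃₂‖² ≤ 5·d·M², and likewise for all y₁, y₂ ∈ B; (iii) consequently, the maximum of ‖p − q‖² over all pairs p, q of points in {x̃ : x ∈ A} ∪ {ỹ : y ∈ B} equals 2W + 2·max_{(x,y) ∈ A×B} x·y, and is attained by a pair consisting of one point from {x̃ : x ∈ A} and one point from {ỹ : y ∈ B}. -/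
open scoped Classical

theorem aux_sq {d : ℕ} {M : ℝ} {x : Fin d → ℝ} (hx : ∀ i, |x i| ≤ M) :
    ∑ i, x i ^ 2 ≤ d * M ^ 2 := by
  have h : ∑ i, x i ^ 2 ≤ ∑ _i : Fin d, M ^ 2 :=
    Finset.sum_le_sum fun i _ => sq_le_sq' (abs_le.1 (hx i)).1 (abs_le.1 (hx i)).2
  simpa using h

theorem aux_diff {d : ℕ} {M : ℝ} {x y : Fin d → ℝ} (hx : ∀ i, |x i| ≤ M)
    (hy : ∀ i, |y i| ≤ M) :
    ∑ i, (x i - y i) ^ 2 ≤ 4 * (d * M ^ 2) := by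
  have h : ∑ i, (x i - y i) ^ 2 ≤ ∑ i, (2 * x i ^ 2 + 2 * y i ^ 2) :=
    Finset.sum_le_sum fun i _ => by nlinarith [sq_nonneg (x i + y i)]
  rw [Finset.sum_add_distrib, ← Finset.mul_sum, ← Finset.mul_sum] at h
  linarith [aux_sq hx, aux_sq hy]

theorem aux_inner {d : ℕ} {M : ℝ} {x y : Fin d → ℝ} (hx : ∀ i, |x i| ≤ M)
    (hy : ∀ i, |y i| ≤ M) :
    -(d * M ^ 2) ≤ ∑ i, x i * y i := by
  have h : 0 ≤ ∑ i, (x i ^ 2 + y i ^ 2 + 2 * (x i * y i)) :=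
    Finset.sum_nonneg fun i _ => by nlinarith [sq_nonneg (x i + y i)]
  rw [Finset.sum_add_distrib, Finset.sum_add_distrib, ← Finset.mul_sum] at h
  linarith [aux_sq hx, aux_sq hy]

theorem aux_sqrt {W a b D : ℝ} (ha : 0 ≤ a) (hb : 0 ≤ b) (haD : a ≤ D) (hbD : b ≤ D)
    (hD : D ≤ W) : (Real.sqrt (W - a) - Real.sqrt (W - b)) ^ 2 ≤ D := by
  have h1 := Real.sq_sqrt (show 0 ≤ W - a by linarith)
  have h2 := Real.sq_sqrt (show 0 ≤ W - b by linarith)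
  have h3 := Real.sqrt_nonneg (W - a)
  have h4 := Real.sqrt_nonneg (W - b)
  rcases le_total (Real.sqrt (W - a)) (Real.sqrt (W - b)) with h | h <;> nlinarith

/-- The reduction from `ℤ-Max-IP` to `ℓ₂`-Furthest Pair: lifting
`x ∈ A` to `x̃ = (x, √(W − ‖x‖²), 0)` and `y ∈ B` to `ỹ = (−y, 0, √(W − ‖y‖²))` in
`ℝ^{d+2}` (indexed by `Fin d ⊕ Fin 2`), one has (i) `‖x̃ − ỹ‖² = 2W + 2(x·y)`;
(ii) squared distances within each side are at most `5dM²`; and (iii) the maximum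
squared distance over all pairs of lifted points equals `2W + 2·max_{A×B} x·y` and is
attained by a mixed pair. -/
theorem ZMaxIP_to_furthest_pair_reduction
    (d : ℕ) (hd : 0 < d) (M : ℝ) (hM : 1 ≤ M)
    (A B : Finset (Fin d → ℝ)) (hA : A.Nonempty) (hB : B.Nonempty)
    (hAbd : ∀ x ∈ A, ∀ i, |x i| ≤ M) (hBbd : ∀ y ∈ B, ∀ i, |y i| ≤ M)
    (W : ℝ) (hW : 5 * d * M ^ 2 ≤ W)
    (tA tB : (Fin d → ℝ) → (Fin d ⊕ Fin 2 → ℝ))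
    (htA : ∀ x, tA x = Sum.elim x
        (fun j => if j = 0 then Real.sqrt (W - ∑ i, x i ^ 2) else 0))
    (htB : ∀ y, tB y = Sum.elim (fun i => -y i)
        (fun j => if j = 0 then 0 else Real.sqrt (W - ∑ i, y i ^ 2))) :
    (∀ x ∈ A, ∀ y ∈ B,
        (∑ i, (tA x i - tB y i) ^ 2) = 2 * W + 2 * ∑ i, x i * y i) ∧
    (∀ x₁ ∈ A, ∀ x₂ ∈ A, (∑ i, (tA x₁ i - tA x₂ i) ^ 2) ≤ 5 * d * M ^ 2) ∧
    (∀ y₁ ∈ B, ∀ y₂ ∈ B, (∑ i, (tB y₁ i - tB y₂ i) ^ 2) ≤ 5 * d * M ^ 2) ∧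
    (((A.image tA ∪ B.image tB) ×ˢ (A.image tA ∪ B.image tB)).sup'
        ((hA.image tA).inl.product (hA.image tA).inl)
        (fun pq => ∑ i, (pq.1 i - pq.2 i) ^ 2) =
      2 * W + 2 * (A ×ˢ B).sup' (hA.product hB) (fun xy => ∑ i, xy.1 i * xy.2 i) ∧
     ∃ x ∈ A, ∃ y ∈ B,
       (∑ i, (tA x i - tB y i) ^ 2) =
         ((A.image tA ∪ B.image tB) ×ˢ (A.image tA ∪ B.image tB)).sup'
           ((hA.image tA).inl.product (hA.image tA).inl)
           (fun pq => ∑ i, (pq.1 i - pq.2 i) ^ 2)) := by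
  have hD : 0 ≤ (d : ℝ) * M ^ 2 := by positivity
  have hDW : (d : ℝ) * M ^ 2 ≤ W := by linarith
  have nn : ∀ x : Fin d → ℝ, 0 ≤ ∑ i, x i ^ 2 := fun x =>
    Finset.sum_nonneg fun i _ => sq_nonneg _
  have h1 : ∀ x ∈ A, ∀ y ∈ B,
      (∑ i, (tA x i - tB y i) ^ 2) = 2 * W + 2 * ∑ i, x i * y i := by
    intro x hx y hy
    have e1 := Real.sq_sqrt (show 0 ≤ W - ∑ i, x i ^ 2 by linarith [aux_sq (hAbd x hx)])
    have e2 := Real.sq_sqrt (show 0 ≤ W - ∑ i, y i ^ 2 by linarith [aux_sq (hBbd y hy)])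
    have e3 : ∑ i, (x i - -y i) ^ 2 = ∑ i, x i ^ 2 + ∑ i, y i ^ 2 + 2 * ∑ i, x i * y i := by
      rw [Finset.mul_sum, ← Finset.sum_add_distrib, ← Finset.sum_add_distrib]
      exact Finset.sum_congr rfl fun i _ => by ring
    rw [htA, htB, Fintype.sum_sum_type, Fin.sum_univ_two]
    simp only [Sum.elim_inl, Sum.elim_inr, if_true, one_ne_zero, if_false, e3]
    linarith
  have h2 : ∀ x₁ ∈ A, ∀ x₂ ∈ A, (∑ i, (tA x₁ i - tA x₂ i) ^ 2) ≤ 5 * d * M ^ 2 := by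
    intro x hx y hy
    have e3 := aux_diff (hAbd x hx) (hAbd y hy)
    have e4 := aux_sqrt (nn x) (nn y) (aux_sq (hAbd x hx)) (aux_sq (hAbd y hy)) hDW
    rw [htA, htA, Fintype.sum_sum_type, Fin.sum_univ_two]
    simp only [Sum.elim_inl, Sum.elim_inr, if_true, one_ne_zero, if_false]
    linarith
  have h3 : ∀ y₁ ∈ B, ∀ y₂ ∈ B, (∑ i, (tB y₁ i - tB y₂ i) ^ 2) ≤ 5 * d * M ^ 2 := by
    intro x hx y hy
    have e3 := aux_diff (hBbd y hy) (hBbd x hx)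
    have e4 := aux_sqrt (nn x) (nn y) (aux_sq (hBbd x hx)) (aux_sq (hBbd y hy)) hDW
    have e5 : ∑ i, (-x i - -y i) ^ 2 = ∑ i, (y i - x i) ^ 2 :=
      Finset.sum_congr rfl fun i _ => by ring
    rw [htB, htB, Fintype.sum_sum_type, Fin.sum_univ_two]
    simp only [Sum.elim_inl, Sum.elim_inr, if_true, one_ne_zero, if_false, e5]
    linarith
  obtain ⟨⟨x0, y0⟩, hm, he⟩ := Finset.exists_mem_eq_sup' (hA.product hB)
    (fun xy : (Fin d → ℝ) × (Fin d → ℝ) => ∑ i, xy.1 i * xy.2 i)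
  have hmax : ∀ x ∈ A, ∀ y ∈ B, ∑ i, x i * y i ≤ ∑ i, x0 i * y0 i := by
    intro x hx y hy
    have := Finset.le_sup' (fun xy : (Fin d → ℝ) × (Fin d → ℝ) => ∑ i, xy.1 i * xy.2 i)
      (Finset.mk_mem_product hx hy)
    rw [he] at this
    exact this
  obtain ⟨hx0, hy0⟩ := Finset.mem_product.1 hm
  have hlow := aux_inner (hAbd x0 hx0) (hBbd y0 hy0)
  have key : ((A.image tA ∪ B.image tB) ×ˢ (A.image tA ∪ B.image tB)).sup'
        ((hA.image tA).inl.product (hA.image tA).inl)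
        (fun pq => ∑ i, (pq.1 i - pq.2 i) ^ 2) = 2 * W + 2 * ∑ i, x0 i * y0 i := by
    apply le_antisymm
    · apply Finset.sup'_le
      rintro ⟨p, q⟩ hpq
      simp only [Finset.mem_product, Finset.mem_union, Finset.mem_image] at hpq
      obtain ⟨⟨x, hx, rfl⟩ | ⟨x, hx, rfl⟩, ⟨y, hy, rfl⟩ | ⟨y, hy, rfl⟩⟩ := hpq
      · have := h2 x hx y hy
        dsimp only
        linarith
      · have := h1 x hx y hy
        have := hmax x hx y hy
        dsimp only
        linarith
      · have h5 := h1 y hy x hx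
        have := hmax y hy x hx
        have h6 : ∑ i, (tB x i - tA y i) ^ 2 = ∑ i, (tA y i - tB x i) ^ 2 :=
          Finset.sum_congr rfl fun i _ => by ring
        dsimp only
        linarith
      · have := h3 x hx y hy
        dsimp only
        linarith
    · rw [← h1 x0 hx0 y0 hy0]
      exact Finset.le_sup' (fun pq : (Fin d ⊕ Fin 2 → ℝ) × (Fin d ⊕ Fin 2 → ℝ) =>
          ∑ i, (pq.1 i - pq.2 i) ^ 2)
        (Finset.mk_mem_product
          (Finset.mem_union_left _ (Finset.mem_image_of_mem tA hx0))
          (Finset.mem_union_right _ (Finset.mem_image_of_mem tB hy0)))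
  refine ⟨h1, h2, h3, ?_, x0, hx0, y0, hy0, ?_⟩
  · rw [key, he]
  · rw [key, h1 x0 hx0 y0 hy0]
end

section
/- Let d be a positive integer, M ≥ 1 a real, and A, B nonempty finite sets of vectors in ℝ^d all of whose coordinates have absolute value at most M. Let W be a real with W ≥ d·M². For x ∈ A define x̃ = (x, √(W − ‖x‖²), 0) ∈ ℝ^{d+2}, and for y ∈ B define ỹ = (y, 0, √(W − ‖y‖²)) ∈ ℝ^{d+2}. Then for all x ∈ A, y ∈ B, ‖x̃ − ỹ‖² = 2W − 2·(x·y); consequently the minimum of ‖x̃ − ỹ‖² over (x,y) ∈ A×B equals 2W − 2·max_{(x,y) ∈ A×B} x·y, and a pair (x,y) minimizes ‖x̃ − ỹ‖ if and only if it maximizes x·y. -/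
theorem inf_eq_antitone_sup {α : Type*} (S : Finset α) (hS : S.Nonempty) (φ : ℝ → ℝ)
    (hφ : Antitone φ) (h g : α → ℝ) (hh : ∀ p ∈ S, h p = φ (g p)) :
    S.inf' hS h = φ (S.sup' hS g) := by
  obtain ⟨p, hp, hpe⟩ := Finset.exists_mem_eq_sup' hS g
  apply le_antisymm
  · rw [hpe, ← hh p hp]
    exact Finset.inf'_le h hp
  · apply Finset.le_inf'
    intro q hq
    rw [hh q hq]
    exact hφ (Finset.le_sup' g hq)

theorem sum_sq_le_of_abs_le (d : ℕ) (M W : ℝ) (hW : (d : ℝ) * M ^ 2 ≤ W) (x : Fin d → ℝ)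
    (hx : ∀ i, |x i| ≤ M) : 0 ≤ W - ∑ i, x i ^ 2 := by
  have h : ∑ i, x i ^ 2 ≤ ∑ _i : Fin d, M ^ 2 :=
    Finset.sum_le_sum fun i _ => sq_le_sq' (abs_le.mp (hx i)).1 (abs_le.mp (hx i)).2
  simp at h
  linarith

/-- The reduction from `ℤ-Max-IP` to Bichromatic `ℓ₂`-Closest Pair:
lifting `x ∈ A` to `x̃ = (x, √(W − ‖x‖²), 0)` and `y ∈ B` to `ỹ = (y, 0, √(W − ‖y‖²))`
in `ℝ^{d+2}` (indexed by `Fin d ⊕ Fin 2`), one has `‖x̃ − ỹ‖² = 2W − 2(x·y)`; hence the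
minimum of `‖x̃ − ỹ‖²` over `A × B` equals `2W − 2·max_{A×B} x·y`, and a pair minimizes
`‖x̃ − ỹ‖` iff it maximizes `x·y`. -/
theorem ZMaxIP_to_bichromatic_closest_pair_reduction
    (d : ℕ) (hd : 0 < d) (M : ℝ) (hM : 1 ≤ M)
    (A B : Finset (Fin d → ℝ)) (hA : A.Nonempty) (hB : B.Nonempty)
    (hAbd : ∀ x ∈ A, ∀ i, |x i| ≤ M) (hBbd : ∀ y ∈ B, ∀ i, |y i| ≤ M)
    (W : ℝ) (hW : (d : ℝ) * M ^ 2 ≤ W)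
    (tA tB : (Fin d → ℝ) → (Fin d ⊕ Fin 2 → ℝ))
    (htA : ∀ x, tA x = Sum.elim x
        (fun j => if j = 0 then Real.sqrt (W - ∑ i, x i ^ 2) else 0))
    (htB : ∀ y, tB y = Sum.elim y
        (fun j => if j = 0 then 0 else Real.sqrt (W - ∑ i, y i ^ 2))) :
    (∀ x ∈ A, ∀ y ∈ B,
        (∑ i, (tA x i - tB y i) ^ 2) = 2 * W - 2 * ∑ i, x i * y i) ∧
    ((A ×ˢ B).inf' (hA.product hB) (fun xy => ∑ i, (tA xy.1 i - tB xy.2 i) ^ 2) =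
      2 * W - 2 * (A ×ˢ B).sup' (hA.product hB) (fun xy => ∑ i, xy.1 i * xy.2 i)) ∧
    (∀ x ∈ A, ∀ y ∈ B,
        (Real.sqrt (∑ i, (tA x i - tB y i) ^ 2) =
            (A ×ˢ B).inf' (hA.product hB)
              (fun xy => Real.sqrt (∑ i, (tA xy.1 i - tB xy.2 i) ^ 2)) ↔
          (∑ i, x i * y i) =
            (A ×ˢ B).sup' (hA.product hB) (fun xy => ∑ i, xy.1 i * xy.2 i))) := by
  have key : ∀ x ∈ A, ∀ y ∈ B,
      (∑ i, (tA x i - tB y i) ^ 2) = 2 * W - 2 * ∑ i, x i * y i := by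
    intro x hx y hy
    have h1 := Real.sq_sqrt (sum_sq_le_of_abs_le d M W hW x (hAbd x hx))
    have h2 := Real.sq_sqrt (sum_sq_le_of_abs_le d M W hW y (hBbd y hy))
    have h3 : ∑ i, (x i - y i) ^ 2 = ∑ i, x i ^ 2 + ∑ i, y i ^ 2 - 2 * ∑ i, x i * y i := by
      rw [Finset.mul_sum, ← Finset.sum_add_distrib, ← Finset.sum_sub_distrib]
      exact Finset.sum_congr rfl fun i _ => by ring
    rw [htA, htB, Fintype.sum_sum_type]
    simp only [Sum.elim_inl, Sum.elim_inr, Fin.sum_univ_two, if_true, one_ne_zero, if_false,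
      sub_zero, zero_sub, neg_sq]
    rw [h1, h2, h3]
    ring
  have key2 : ∀ p ∈ A ×ˢ B, (∑ i, (tA p.1 i - tB p.2 i) ^ 2) =
      2 * W - 2 * ∑ i, p.1 i * p.2 i := fun p hp =>
    key _ (Finset.mem_product.mp hp).1 _ (Finset.mem_product.mp hp).2
  refine ⟨key, ?_, ?_⟩
  · exact inf_eq_antitone_sup (A ×ˢ B) (hA.product hB) (fun t => 2 * W - 2 * t)
      (fun a b hab => by dsimp only; linarith) _ _ key2
  · intro x hx y hy
    rw [inf_eq_antitone_sup (A ×ˢ B) (hA.product hB) (fun t => Real.sqrt (2 * W - 2 * t))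
      (fun a b hab => Real.sqrt_le_sqrt (by linarith)) _ (fun p => ∑ i, p.1 i * p.2 i)
      (fun p hp => by rw [key2 p hp]), key x hx y hy]
    obtain ⟨p, hp, hpe⟩ := Finset.exists_mem_eq_sup' (hA.product hB)
      (fun p : (Fin d → ℝ) × (Fin d → ℝ) => ∑ i, p.1 i * p.2 i)
    rw [hpe]
    rw [Real.sqrt_inj]
    · constructor <;> intro h <;> linarith
    · rw [← key x hx y hy]
      positivity
    · rw [← key2 p hp]
      positivity
end

section
/- There is a universal constant c₁ ≥ 1 such that for every positive integer d and every real ε ∈ (0,1), setting D = ⌈c₁·√(d·log₂(1/ε))⌉, there exist an integer d₁ with d₁ ≤ (∑_{k=0}^{D} C(d,k))³ · 2^D · ⌈1/ε⌉ · c₁, a real T > 1/ε, and functions f, g : {0,1}^d → {−1,1}^{d₁} such that for all x, y ∈ {0,1}^d: if x·y = 0 then f(x)·g(y) ≥ T, and if x·y ≥ 1 then |f(x)·g(y)| ≤ ε·T. -/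
open Polynomial in
lemma cheb_affine (k : ℕ) (a b : ℝ) : ∃ q : ℝ[X], q.natDegree ≤ k ∧
    ∀ t : ℝ, q.eval t = (Chebyshev.T ℝ k).eval (a + b * t) := by
  refine ⟨(Chebyshev.T ℝ k).comp (C a + C b * X), ?_, ?_⟩
  · refine natDegree_comp_le.trans ?_
    have h1 : (C a + C b * X : ℝ[X]).natDegree ≤ 1 := by
      compute_degree
    have h2 : (Chebyshev.T ℝ (k : ℤ)).natDegree = k := by
      rw [Chebyshev.natDegree_T]; simp
    rw [h2]
    calc k * _ ≤ k * 1 := Nat.mul_le_mul_left _ h1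
      _ = k := mul_one k
  · intro t; simp [eval_comp]

open Polynomial in
lemma cheb_growth (x : ℝ) (hx : 0 ≤ x) (k : ℕ) :
    1 + (k : ℝ) ^ 2 * x ≤ (Chebyshev.T ℝ k).eval (1 + x) := by
  have key : ∀ n : ℕ, 1 + (n : ℝ) ^ 2 * x ≤ (Chebyshev.T ℝ n).eval (1 + x) ∧
      (2 * n + 1) * x ≤ (Chebyshev.T ℝ ((n : ℤ) + 1)).eval (1 + x)
        - (Chebyshev.T ℝ n).eval (1 + x) := by
    intro n
    induction n with
    | zero => simp
    | succ n ih =>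
      obtain ⟨h1, h2⟩ := ih
      have h3 : 1 + ((n + 1 : ℕ) : ℝ) ^ 2 * x ≤
          (Chebyshev.T ℝ ((n : ℤ) + 1)).eval (1 + x) := by
        push_cast; nlinarith
      have h4 : (Chebyshev.T ℝ ((n : ℤ) + 1 + 1)).eval (1 + x) =
          2 * (1 + x) * (Chebyshev.T ℝ ((n : ℤ) + 1)).eval (1 + x)
            - (Chebyshev.T ℝ n).eval (1 + x) := by
        rw [Chebyshev.T_add_one]; simp
      refine ⟨by exact_mod_cast h3, ?_⟩
      push_cast
      rw [h4]
      have h5 : 1 ≤ (Chebyshev.T ℝ ((n : ℤ) + 1)).eval (1 + x) := by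
        refine le_trans ?_ h3
        have : 0 ≤ ((n + 1 : ℕ) : ℝ) ^ 2 * x := by positivity
        linarith
      nlinarith
  exact (key k).1

lemma ceil_sqrt_le (a : ℝ) (ha : 1 ≤ a) : (⌈Real.sqrt a⌉₊ : ℝ) ≤ 2 * Real.sqrt a := by
  have h1 : 1 ≤ Real.sqrt a := Real.one_le_sqrt.mpr ha
  have := Nat.ceil_lt_add_one (Real.sqrt_nonneg a)
  linarith

/-- polynomial vanishing at `i`, equal to one at `0`, bounded by one on `[0,d]`. -/
lemma killer (d i : ℕ) (hi : 1 ≤ i) (hid : i ≤ d) : ∃ q : Polynomial ℝ,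
    (q.natDegree : ℝ) ≤ 2 * Real.sqrt (d / i) ∧ q.eval 0 = 1 ∧ q.eval (i : ℝ) = 0 ∧
    ∀ t : ℝ, 0 ≤ t → t ≤ d → |q.eval t| ≤ 1 := by
  have hi0 : (1 : ℝ) ≤ i := by exact_mod_cast hi
  have hid' : (i : ℝ) ≤ d := by exact_mod_cast hid
  have hdi : (1 : ℝ) ≤ d / i := by rw [le_div_iff₀ (by linarith)]; linarith
  set m : ℕ := ⌈Real.sqrt (d / i)⌉₊ with hm
  have hm2 : Real.sqrt (d / i) ≤ m := Nat.le_ceil _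
  have hm1 : (1 : ℝ) ≤ m := (Real.one_le_sqrt.mpr hdi).trans hm2
  have hmsq : (d : ℝ) / i ≤ (m : ℝ) ^ 2 := (Real.sqrt_le_left (by linarith)).mp hm2
  set y : ℝ := Real.pi / (2 * m) with hy
  set s : ℝ := (1 - Real.cos y) / i with hs
  have hs0 : 0 ≤ s := div_nonneg (by linarith [Real.cos_le_one y]) (by linarith)
  have hsd : s * d ≤ 2 := by
    have hc := Real.one_sub_sq_div_two_le_cos (x := y)
    have h1 : s * d = (1 - Real.cos y) * (d / i) := by rw [hs]; ring
    have h2 : y ^ 2 * (m : ℝ) ^ 2 ≤ 4 := by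
      have : y * m = Real.pi / 2 := by rw [hy]; field_simp
      have h3 := Real.pi_le_four
      have h4 := Real.pi_pos
      rw [← mul_pow, this]; nlinarith
    rw [h1]
    calc (1 - Real.cos y) * (d / i) ≤ (y ^ 2 / 2) * (m : ℝ) ^ 2 := by
          apply mul_le_mul _ hmsq (by linarith) (by positivity)
          linarith
      _ ≤ 2 := by linarith
  obtain ⟨q, hq1, hq2⟩ := cheb_affine m 1 (-s)
  refine ⟨q, ?_, ?_, ?_, ?_⟩
  · refine le_trans ?_ (ceil_sqrt_le _ hdi)
    exact_mod_cast hq1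
  · rw [hq2]; simp
  · rw [hq2]
    have : 1 + -s * i = Real.cos y := by rw [hs]; field_simp; ring
    rw [this, Polynomial.Chebyshev.T_real_cos]
    have : ((m : ℤ) : ℝ) * y = Real.pi / 2 := by rw [hy]; push_cast; field_simp
    rw [this, Real.cos_pi_div_two]
  · intro t ht htd
    rw [hq2]
    apply Polynomial.Chebyshev.abs_eval_T_real_le_one
    rw [abs_le]
    have : s * t ≤ s * d := mul_le_mul_of_nonneg_left htd hs0
    have : 0 ≤ s * t := mul_nonneg hs0 ht
    constructor <;> linarith

lemma sum_sqrt_step (d l : ℕ) :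
    2 * Real.sqrt (d / (l + 1 : ℕ)) + 4 * Real.sqrt (d * l) ≤ 4 * Real.sqrt (d * (l + 1 : ℕ)) := by
  rw [Real.sqrt_div (by positivity), Real.sqrt_mul (by positivity), Real.sqrt_mul (by positivity)]
  have hb : 0 < Real.sqrt ((l + 1 : ℕ) : ℝ) := Real.sqrt_pos.mpr (by positivity)
  have hb2 : Real.sqrt ((l + 1 : ℕ) : ℝ) ^ 2 = l + 1 := by
    rw [Real.sq_sqrt (by positivity)]; push_cast; ring
  have ha2 : Real.sqrt (l : ℝ) ^ 2 = l := Real.sq_sqrt (by positivity)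
  set a := Real.sqrt (l : ℝ)
  set b := Real.sqrt ((l + 1 : ℕ) : ℝ)
  have hd : 0 ≤ Real.sqrt (d : ℝ) := Real.sqrt_nonneg _
  have key : 2 / b + 4 * a ≤ 4 * b := by
    rw [div_add' _ _ _ hb.ne', div_le_iff₀ hb]
    nlinarith [sq_nonneg (a - b)]
  calc _ = Real.sqrt d * (2 / b + 4 * a) := by ring
    _ ≤ Real.sqrt d * (4 * b) := mul_le_mul_of_nonneg_left key hd
    _ = _ := by ring

lemma killers (d : ℕ) (l : ℕ) (hl : l ≤ d) : ∃ q : Polynomial ℝ,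
    (q.natDegree : ℝ) ≤ 4 * Real.sqrt (d * l) ∧ q.eval 0 = 1 ∧
    (∀ i : ℕ, 1 ≤ i → i ≤ l → q.eval (i : ℝ) = 0) ∧
    ∀ t : ℝ, 0 ≤ t → t ≤ d → |q.eval t| ≤ 1 := by
  induction l with
  | zero => exact ⟨1, by simp, by simp, by intro i h1 h2; omega, by simp⟩
  | succ l ih =>
    obtain ⟨q, h1, h2, h3, h4⟩ := ih (by omega)
    obtain ⟨r, k1, k2, k3, k4⟩ := killer d (l + 1) (by omega) hl
    refine ⟨r * q, ?_, by simp [h2, k2], ?_, ?_⟩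
    · have := sum_sqrt_step d l
      have h5 : ((r * q).natDegree : ℝ) ≤ r.natDegree + q.natDegree := by
        exact_mod_cast Polynomial.natDegree_mul_le
      linarith
    · intro i hi hil
      rcases Nat.lt_or_ge l i with h | h
      · have : i = l + 1 := by omega
        subst this
        rw [Polynomial.eval_mul, k3, zero_mul]
      · simp [h3 i hi h]
    · intro t ht htd
      rw [Polynomial.eval_mul, abs_mul]
      exact mul_le_one₀ (k4 t ht htd) (abs_nonneg _) (h4 t ht htd)

/-- Normalised Chebyshev polynomial on `[l,d]`. -/
lemma cheb_norm (d l k : ℕ) (hd : 0 < d) : ∃ q : Polynomial ℝ,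
    q.natDegree ≤ k ∧ q.eval 0 = 1 ∧
    ∀ t : ℝ, (l : ℝ) ≤ t → t ≤ d → |q.eval t| ≤ 1 / (1 + (k : ℝ) ^ 2 * (2 * l / d)) := by
  have hd' : (0 : ℝ) < d := by exact_mod_cast hd
  obtain ⟨q, hq1, hq2⟩ := cheb_affine k (1 + 2 * l / d) (-(2 / d))
  have hg := cheb_growth (2 * l / d) (by positivity) k
  have hpos : 0 < 1 + (k : ℝ) ^ 2 * (2 * l / d) := by positivity
  set A := (Polynomial.Chebyshev.T ℝ k).eval (1 + 2 * (l : ℝ) / d) with hA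
  have hApos : 0 < A := lt_of_lt_of_le hpos hg
  refine ⟨Polynomial.C A⁻¹ * q, (Polynomial.natDegree_C_mul_le _ _).trans hq1, ?_, ?_⟩
  · rw [Polynomial.eval_mul, hq2]; simp [← hA, hApos.ne']
  · intro t ht htd
    rw [Polynomial.eval_mul, hq2, Polynomial.eval_C, abs_mul, abs_of_pos (inv_pos.mpr hApos)]
    have h1 : |(Polynomial.Chebyshev.T ℝ k).eval (1 + 2 * (l : ℝ) / d + -(2 / d) * t)| ≤ 1 := by
      apply Polynomial.Chebyshev.abs_eval_T_real_le_one
      have e : 1 + 2 * (l : ℝ) / d + -(2 / d) * t = 1 - 2 * ((t - l) / d) := by ring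
      have h0 : 0 ≤ (t - l) / d := div_nonneg (by linarith) hd'.le
      have h1 : (t - l) / d ≤ 1 := by
        rw [div_le_one hd']; have : (0 : ℝ) ≤ l := by positivity
        linarith
      rw [e, abs_le]; constructor <;> linarith
    calc A⁻¹ * _ ≤ A⁻¹ * 1 := mul_le_mul_of_nonneg_left h1 (inv_pos.mpr hApos).le
      _ = 1 / A := by ring
      _ ≤ _ := one_div_le_one_div_of_le hpos hg

lemma big_approx (d l : ℕ) (hl : 1 ≤ l) (hld : l ≤ d) : ∃ p : Polynomial ℝ,
    (p.natDegree : ℝ) ≤ 8 * Real.sqrt (d * l) ∧ p.eval 0 = 1 ∧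
    ∀ t : ℕ, 1 ≤ t → t ≤ d → |p.eval (t : ℝ)| ≤ (1 / 2) ^ (l + 1) := by
  have hl' : (1 : ℝ) ≤ l := by exact_mod_cast hl
  have hld' : (l : ℝ) ≤ d := by exact_mod_cast hld
  have hdl : (1 : ℝ) ≤ d / l := by rw [le_div_iff₀ (by linarith)]; linarith
  obtain ⟨q, h1, h2, h3, h4⟩ := killers d l hld
  set k : ℕ := ⌈Real.sqrt (d / l)⌉₊ with hk
  obtain ⟨r, k1, k2, k3⟩ := cheb_norm d l k (by omega)
  have hksq : (d : ℝ) / l ≤ (k : ℝ) ^ 2 := (Real.sqrt_le_left (by positivity)).mp (Nat.le_ceil _)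
  refine ⟨q * r ^ (2 * l), ?_, by simp [h2, k2], ?_⟩
  · have e1 : (q * r ^ (2 * l)).natDegree ≤ q.natDegree + 2 * l * k :=
      Polynomial.natDegree_mul_le.trans (Nat.add_le_add_left
        (Polynomial.natDegree_pow_le.trans (Nat.mul_le_mul_left _ k1)) _)
    have e2 : ((q * r ^ (2 * l)).natDegree : ℝ) ≤ q.natDegree + 2 * l * k := by exact_mod_cast e1
    have e3 := ceil_sqrt_le _ hdl
    rw [← hk] at e3
    have e4 : (l : ℝ) * Real.sqrt (d / l) = Real.sqrt (d * l) := by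
      have : (d : ℝ) * l = l ^ 2 * (d / l) := by field_simp
      rw [this, Real.sqrt_mul (by positivity), Real.sqrt_sq (by positivity)]
    have e5 : (l : ℝ) * k ≤ l * (2 * Real.sqrt (d / l)) :=
      mul_le_mul_of_nonneg_left e3 (by linarith)
    linarith
  · intro t ht htd
    have htd' : (t : ℝ) ≤ d := by exact_mod_cast htd
    rcases Nat.lt_or_ge l t with h | h
    · have hlt : (l : ℝ) ≤ t := by exact_mod_cast h.le
      have f1 := k3 t hlt htd'
      have f2 : 2 ≤ (k : ℝ) ^ 2 * (2 * l / d) := by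
        have hdne : (d : ℝ) ≠ 0 := by linarith
        have : (2 : ℝ) = (d / l) * (2 * l / d) := by field_simp
        calc (2 : ℝ) = (d / l) * (2 * l / d) := this
          _ ≤ _ := mul_le_mul_of_nonneg_right hksq (by positivity)
      have f3 : |r.eval (t : ℝ)| ≤ 1 / 2 := by
        refine f1.trans (one_div_le_one_div_of_le (by norm_num) (by linarith))
      rw [Polynomial.eval_mul, Polynomial.eval_pow, abs_mul, abs_pow]
      calc _ ≤ 1 * (1 / 2 : ℝ) ^ (2 * l) :=
            mul_le_mul (h4 t (by positivity) htd') (pow_le_pow_left₀ (abs_nonneg _) f3 _)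
              (by positivity) (by norm_num)
        _ ≤ _ := by
          rw [one_mul]
          exact pow_le_pow_of_le_one (by norm_num) (by norm_num) (by omega)
    · simp [h3 t ht h]

lemma exact_poly (d : ℕ) : ∃ p : Polynomial ℝ, p.natDegree ≤ d ∧ p.eval 0 = 1 ∧
    ∀ t : ℕ, 1 ≤ t → t ≤ d → p.eval (t : ℝ) = 0 := by
  induction d with
  | zero => exact ⟨1, by simp, by simp, by intro i h1 h2; omega⟩
  | succ d ih =>
    obtain ⟨q, h1, h2, h3⟩ := ih
    refine ⟨q * (Polynomial.C 1 + Polynomial.C (-((d : ℝ) + 1)⁻¹) * Polynomial.X), ?_, ?_, ?_⟩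
    · refine Polynomial.natDegree_mul_le.trans (Nat.add_le_add h1 ?_)
      compute_degree
    · simp [h2]
    · intro t ht htd
      rcases Nat.lt_or_ge d t with h | h
      · have : t = d + 1 := by omega
        subst this
        have : (d : ℝ) + 1 ≠ 0 := by positivity
        simp [this]
      · simp [h3 t ht h]

/-- The approximating polynomial in all regimes. -/
lemma approx_poly (d : ℕ) (hd : 0 < d) (ε : ℝ) (h0 : 0 < ε) (h1 : ε < 1) :
    ∃ p : Polynomial ℝ,
      p.natDegree ≤ ⌈((12 : ℕ) : ℝ) * Real.sqrt (d * Real.logb 2 (1 / ε))⌉₊ ∧ p.eval 0 = 1 ∧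
      ∀ t : ℕ, 1 ≤ t → t ≤ d →
        |p.eval (t : ℝ)| ≤ ε * (1 - 1 / (2 * ((d : ℝ) + 2))) := by
  have hd' : (1 : ℝ) ≤ d := by exact_mod_cast hd
  set L := Real.logb 2 (1 / ε) with hL
  have hLpos : 0 < L := Real.logb_pos (by norm_num) (by rw [lt_div_iff₀ h0]; linarith)
  have hεL : (2 : ℝ) ^ L = 1 / ε := Real.rpow_logb (by norm_num) (by norm_num) (by positivity)
  have hhalf : ε * (1 / 2) ≤ ε * (1 - 1 / (2 * ((d : ℝ) + 2))) := by
    apply mul_le_mul_of_nonneg_left _ h0.le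
    have : 1 / (2 * ((d : ℝ) + 2)) ≤ 1 / 2 := one_div_le_one_div_of_le (by norm_num) (by linarith)
    linarith
  have hceil := Nat.le_ceil (((12 : ℕ) : ℝ) * Real.sqrt (d * L))
  set D := ⌈((12 : ℕ) : ℝ) * Real.sqrt (d * L)⌉₊ with hD
  push_cast at hceil
  have hDpos : 0 < D := Nat.ceil_pos.mpr (by positivity)
  rcases lt_or_ge L 1 with hL1 | hL1
  · obtain ⟨p, p1, p2, p3⟩ := cheb_norm d 1 D hd
    refine ⟨p, p1, p2, ?_⟩
    intro t ht htd
    refine (p3 t (by exact_mod_cast ht) (by exact_mod_cast htd)).trans ?_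
    have hD1 : (1 : ℝ) ≤ D := by exact_mod_cast hDpos
    set m : ℝ := (D : ℝ) ^ 2 * (2 * ((1 : ℕ) : ℝ) / d) with hm
    have hmd : m * d = 2 * (D : ℝ) ^ 2 := by rw [hm]; push_cast; field_simp
    have hm1 : 2 ≤ m * d := by rw [hmd]; nlinarith
    have hm2 : 2 * L ≤ m := by
      have : 144 * (d * L) ≤ (D : ℝ) ^ 2 := by
        calc 144 * (d * L) = (12 * Real.sqrt (d * L)) ^ 2 := by
              rw [mul_pow, Real.sq_sqrt (by positivity)]; ring
          _ ≤ _ := pow_le_pow_left₀ (by positivity) hceil 2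
      have h5 : (2 * L) * d ≤ m * d := by
        rw [hmd]; have : 0 < d * L := by positivity
        linarith
      exact le_of_mul_le_mul_right h5 (by linarith)
    have hε : 1 / ε ≤ 1 + L := by
      rw [← hεL]
      have := rpow_one_add_le_one_add_mul_self (s := 1) (p := L) (by norm_num) hLpos.le hL1.le
      norm_num at this
      linarith
    have hε2 : 1 ≤ ε * (1 + m / 2) := by
      rw [div_le_iff₀ h0] at hε
      nlinarith
    rw [div_le_iff₀ (by linarith)]
    have h6 : 1 + m / 2 ≤ (1 - 1 / (2 * ((d : ℝ) + 2))) * (1 + m) := by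
      have : 1 - 1 / (2 * ((d : ℝ) + 2)) = (2 * d + 3) / (2 * (d + 2)) := by
        field_simp; ring
      rw [this, div_mul_eq_mul_div, le_div_iff₀ (by linarith)]
      nlinarith
    calc (1 : ℝ) ≤ ε * (1 + m / 2) := hε2
      _ ≤ ε * ((1 - 1 / (2 * ((d : ℝ) + 2))) * (1 + m)) := mul_le_mul_of_nonneg_left h6 h0.le
      _ = _ := by ring
  · rcases le_or_gt L d with hLd | hLd
    · set l := ⌈L⌉₊ with hl
      have hlL : L ≤ l := Nat.le_ceil _
      have hl2 : (l : ℝ) ≤ 2 * L := by have := Nat.ceil_lt_add_one hLpos.le; linarith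
      have hl1 : 1 ≤ l := Nat.ceil_pos.mpr hLpos
      obtain ⟨p, p1, p2, p3⟩ := big_approx d l hl1 (Nat.ceil_le.mpr hLd)
      refine ⟨p, ?_, p2, ?_⟩
      · have : (p.natDegree : ℝ) ≤ D := by
          refine (p1.trans ?_).trans hceil
          have e : (8 : ℝ) * Real.sqrt (d * l) = Real.sqrt (64 * (d * l)) := by
            rw [show (64 : ℝ) = 8 ^ 2 by norm_num, Real.sqrt_mul (by norm_num) (d * l),
              Real.sqrt_sq (by norm_num)]
          have e144 : (12 : ℝ) * Real.sqrt (d * L) = Real.sqrt (144 * (d * L)) := by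
            rw [show (144 : ℝ) = 12 ^ 2 by norm_num, Real.sqrt_mul (by norm_num) (d * L),
              Real.sqrt_sq (by norm_num)]
          rw [e, e144]
          apply Real.sqrt_le_sqrt
          have : (d : ℝ) * l ≤ d * (2 * L) := mul_le_mul_of_nonneg_left hl2 (by linarith)
          have : 0 < d * L := by positivity
          linarith
        exact_mod_cast this
      · intro t ht htd
        refine (p3 t ht htd).trans (le_trans ?_ hhalf)
        have : (1 / 2 : ℝ) ^ l ≤ ε := by
          have h7 : 1 / ε ≤ (2 : ℝ) ^ l := by
            rw [← hεL, ← Real.rpow_natCast]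
            exact Real.rpow_le_rpow_of_exponent_le (by norm_num) hlL
          rw [one_div_pow]
          rw [div_le_iff₀ h0] at h7
          rw [div_le_iff₀ (by positivity)]
          linarith
        rw [pow_succ]; linarith
    · obtain ⟨p, p1, p2, p3⟩ := exact_poly d
      refine ⟨p, p1.trans ?_, p2, ?_⟩
      · have : (d : ℝ) ≤ D := by
          refine le_trans ?_ hceil
          have : (d : ℝ) ≤ Real.sqrt (d * L) := by
            apply Real.le_sqrt_of_sq_le
            nlinarith
          have := Real.sqrt_nonneg (d * L)
          linarith
        exact_mod_cast this
      · intro t ht htd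
        rw [p3 t ht htd, abs_zero]
        exact le_trans (by positivity) hhalf


lemma embed_signs {V W α : Type*} [Fintype α] (b : α → ℤ) (X : V → α → Bool) (Y : W → α → Bool) :
    ∃ (f : V → Fin (∑ a, (b a).natAbs * 4) → ℤ) (g : W → Fin (∑ a, (b a).natAbs * 4) → ℤ),
      (∀ x i, f x i = 1 ∨ f x i = -1) ∧ (∀ y i, g y i = 1 ∨ g y i = -1) ∧
      ∀ x y, ∑ i, f x i * g y i = 4 * ∑ a, if X x a && Y y a then b a else 0 := by
  classical
  let ι := Σ a : α, Fin (b a).natAbs × (Bool × Bool)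
  have hcard : Fintype.card ι = ∑ a, (b a).natAbs * 4 := by
    simp [ι, Fintype.card_sigma]
  let e : ι ≃ Fin (∑ a, (b a).natAbs * 4) := Fintype.equivFinOfCardEq hcard
  let F : V → ι → ℤ := fun x i =>
    (if 0 ≤ b i.1 then 1 else -1) * (if X x i.1 || i.2.2.1 then 1 else -1)
  let G : W → ι → ℤ := fun y i => if Y y i.1 || i.2.2.2 then 1 else -1
  refine ⟨fun x i => F x (e.symm i), fun y i => G y (e.symm i), ?_, ?_, ?_⟩
  · intro x i
    simp only [F]
    split_ifs <;> simp
  · intro y i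
    simp only [G]
    split_ifs <;> simp
  · intro x y
    rw [Equiv.sum_comp e.symm (fun i => F x i * G y i)]
    rw [Fintype.sum_sigma, Finset.mul_sum]
    refine Finset.sum_congr rfl fun a _ => ?_
    rw [Fintype.sum_prod_type]
    have inner : ∀ j : Fin (b a).natAbs, ∑ r : Bool × Bool, F x ⟨a, j, r⟩ * G y ⟨a, j, r⟩ =
        (if 0 ≤ b a then 1 else -1) * (if X x a && Y y a then 4 else 0) := by
      intro j
      simp only [F, G, Fintype.sum_prod_type, Fintype.sum_bool]
      rcases Bool.eq_false_or_eq_true (X x a) with hX | hX <;>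
      rcases Bool.eq_false_or_eq_true (Y y a) with hY | hY <;>
      simp [hX, hY] <;> split_ifs <;> norm_num
    rw [Finset.sum_congr rfl fun j _ => inner j, Finset.sum_const, Finset.card_univ,
      Fintype.card_fin, nsmul_eq_mul]
    by_cases h : 0 ≤ b a
    · have := Int.natAbs_of_nonneg h
      rw [this, if_pos h]
      split_ifs <;> ring
    · have := Int.ofNat_natAbs_of_nonpos (not_le.mp h).le
      rw [this, if_neg h]
      split_ifs <;> ring

lemma newton_coeff (p : Polynomial ℝ) (D : ℕ) (hp : p.natDegree ≤ D) : ∃ a : ℕ → ℝ,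
    (∀ m, D < m → a m = 0) ∧
    (∀ t : ℕ, p.eval (t : ℝ) = ∑ m ∈ Finset.range (t + 1), (t.choose m : ℝ) * a m) ∧
    (∀ m : ℕ, (∀ t : ℕ, t ≤ m → |p.eval (t : ℝ)| ≤ 1) → |a m| ≤ 2 ^ m) := by
  refine ⟨fun m => (fwdDiff (1 : ℝ))^[m] (fun x => p.eval x) 0, ?_, ?_, ?_⟩
  · intro m hm
    have := Polynomial.fwdDiff_iter_eq_zero_of_degree_lt (P := p) (lt_of_le_of_lt hp hm)
    exact congr_fun this 0
  · intro t
    have := shift_eq_sum_fwdDiff_iter (1 : ℝ) (fun x => p.eval x) t 0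
    simpa using this
  · intro m hm
    simp only
    rw [fwdDiff_iter_eq_sum_shift]
    refine (Finset.abs_sum_le_sum_abs _ _).trans ?_
    have h2 : (2 : ℝ) ^ m = ∑ k ∈ Finset.range (m + 1), (m.choose k : ℝ) := by
      exact_mod_cast (Nat.sum_range_choose m).symm
    rw [h2]
    refine Finset.sum_le_sum fun k hk => ?_
    have hk' : k ≤ m := by simpa [Nat.lt_succ_iff] using hk
    have := hm k hk'
    simp only [zsmul_eq_mul, zero_add, nsmul_eq_mul, mul_one, abs_mul]
    push_cast
    rw [abs_mul, abs_pow, abs_neg, abs_one, one_pow, one_mul, Nat.abs_cast]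
    exact mul_le_of_le_one_right (by positivity) this

lemma indicator_sum_le (d D t : ℕ) (ht : t ≤ d) :
    ∑ m ∈ Finset.range (t + 1), (t.choose m) * (if m ≤ D then 1 else 0) ≤
      ∑ k ∈ Finset.range (D + 1), d.choose k := by
  simp only [mul_ite, mul_one, mul_zero]
  rw [← Finset.sum_filter]
  calc _ ≤ ∑ m ∈ Finset.range (t + 1) with m ≤ D, d.choose m :=
        Finset.sum_le_sum fun m _ => Nat.choose_le_choose m ht
    _ ≤ _ := by
      apply Finset.sum_le_sum_of_subset
      intro m hm
      simp at hm ⊢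
      omega

lemma subset_sum (d : ℕ) (φ : ℕ → ℤ) (x y : Fin d → Bool) :
    ∃ t : ℕ, t ≤ d ∧ (∑ i, ((x i).toNat : ℤ) * ((y i).toNat : ℤ)) = t ∧
      (∑ A : Finset (Fin d), if (decide (∀ i ∈ A, x i = true) && decide (∀ i ∈ A, y i = true))
        then φ A.card else 0) = ∑ m ∈ Finset.range (t + 1), (t.choose m : ℤ) * φ m := by
  classical
  set I : Finset (Fin d) := Finset.univ.filter (fun i => x i = true ∧ y i = true) with hI
  refine ⟨I.card, ?_, ?_, ?_⟩
  · simpa using I.card_le_univ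
  · rw [hI, Finset.card_filter]
    push_cast
    refine Finset.sum_congr rfl fun i _ => ?_
    cases x i <;> cases y i <;> simp
  · have := Finset.sum_powerset_apply_card φ (x := I)
    simp only [nsmul_eq_mul] at this
    rw [← this, ← Finset.sum_filter]
    refine Finset.sum_congr ?_ fun _ _ => rfl
    ext A
    simp only [Finset.mem_filter, Finset.mem_univ, true_and, Finset.mem_powerset,
      Bool.and_eq_true, decide_eq_true_eq, Finset.subset_iff, hI]
    exact ⟨fun h i hi => ⟨h.1 i hi, h.2 i hi⟩, fun h => ⟨fun i hi => (h hi).1, fun i hi => (h hi).2⟩⟩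

lemma reduction (d D : ℕ) (hD : 0 < D) (ε : ℝ) (h0 : 0 < ε) (h1 : ε < 1)
    (p : Polynomial ℝ) (hp : p.natDegree ≤ D) (hp0 : p.eval 0 = 1)
    (hpt : ∀ t : ℕ, 1 ≤ t → t ≤ d → |p.eval (t : ℝ)| ≤ ε * (1 - 1 / (2 * ((d : ℝ) + 2)))) :
    ∃ d₁ : ℕ, d₁ ≤ (∑ k ∈ Finset.range (D + 1), d.choose k) ^ 3 * 2 ^ D * ⌈1 / ε⌉₊ * 12 ∧
      ∃ T : ℝ, 1 / ε < T ∧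
          ∃ f g : (Fin d → Bool) → (Fin d₁ → ℤ),
            (∀ x i, f x i = 1 ∨ f x i = -1) ∧
            (∀ y i, g y i = 1 ∨ g y i = -1) ∧
            (∀ x y : Fin d → Bool,
              ((∑ i, ((x i).toNat : ℤ) * ((y i).toNat : ℤ)) = 0 →
                T ≤ ((∑ i, f x i * g y i : ℤ) : ℝ)) ∧
              (1 ≤ (∑ i, ((x i).toNat : ℤ) * ((y i).toNat : ℤ)) →
                (|(∑ i, f x i * g y i : ℤ)| : ℝ) ≤ ε * T)) := by
  obtain ⟨a, ha1, ha2, ha3⟩ := newton_coeff p D hp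
  set S : ℕ := ∑ k ∈ Finset.range (D + 1), d.choose k with hS
  set E : ℕ := ⌈1 / ε⌉₊ with hE
  have hE1 : 1 ≤ E := Nat.ceil_pos.mpr (by positivity)
  have hEε : 1 ≤ E * ε := by
    have := Nat.le_ceil (1 / ε)
    rwa [div_le_iff₀ h0] at this
  have hSd : d + 1 ≤ S := by
    have : ∑ k ∈ Finset.range 2, d.choose k ≤ S :=
      Finset.sum_le_sum_of_subset (Finset.range_subset_range.mpr (by omega))
    simp [Finset.sum_range_succ] at this
    omega
  set M : ℕ := S * (d + 2) * E with hM
  let φ : ℕ → ℤ := fun m => if m ≤ D then round ((M : ℝ) * a m) else 0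
  have hbd1 : ∀ t : ℕ, t ≤ d → |p.eval (t : ℝ)| ≤ 1 := by
    intro t ht
    rcases Nat.eq_zero_or_pos t with h | h
    · subst h; simp [hp0]
    · refine (hpt t h ht).trans ?_
      have : 0 ≤ 1 / (2 * ((d : ℝ) + 2)) := by positivity
      nlinarith
  have hφ : ∀ m, |(φ m : ℝ) - M * a m| ≤ (1 / 2) * (if m ≤ D then 1 else 0) := by
    intro m
    by_cases h : m ≤ D
    · simp only [φ, h, if_true]
      rw [abs_sub_comm, mul_one]; exact abs_sub_round _
    · simp [φ, h, ha1 m (not_le.mp h)]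
  -- the value function
  have hval : ∀ t : ℕ, t ≤ d →
      |(((∑ m ∈ Finset.range (t + 1), (t.choose m : ℤ) * φ m : ℤ)) : ℝ) - M * p.eval (t : ℝ)|
        ≤ S / 2 := by
    intro t ht
    rw [ha2 t, Finset.mul_sum]
    push_cast
    rw [← Finset.sum_sub_distrib]
    refine (Finset.abs_sum_le_sum_abs _ _).trans ?_
    have h3 := indicator_sum_le d D t ht
    have h4 : (∑ m ∈ Finset.range (t + 1), (t.choose m : ℝ) * (if m ≤ D then 1 else 0)) ≤ S := by
      have : ((∑ m ∈ Finset.range (t + 1), (t.choose m) * (if m ≤ D then 1 else 0) : ℕ) : ℝ) ≤ S :=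
        by exact_mod_cast h3
      simpa using this
    calc _ ≤ ∑ m ∈ Finset.range (t + 1), (1 / 2) * ((t.choose m : ℝ) * (if m ≤ D then 1 else 0)) := by
          refine Finset.sum_le_sum fun m _ => ?_
          have : (t.choose m : ℝ) * (φ m) - M * ((t.choose m : ℝ) * a m)
            = (t.choose m : ℝ) * (φ m - M * a m) := by ring
          rw [this, abs_mul, Nat.abs_cast]
          calc _ ≤ (t.choose m : ℝ) * ((1 / 2) * (if m ≤ D then 1 else 0)) :=
                mul_le_mul_of_nonneg_left (hφ m) (by positivity)
            _ = _ := by ring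
      _ ≤ _ := by rw [← Finset.mul_sum]; linarith
  obtain ⟨f, g, hf, hg, hfg⟩ := embed_signs (fun A : Finset (Fin d) => φ A.card)
    (fun (x : Fin d → Bool) A => decide (∀ i ∈ A, x i = true))
    (fun (x : Fin d → Bool) A => decide (∀ i ∈ A, x i = true))
  refine ⟨_, ?_, 4 * (M : ℝ), ?_, f, g, hf, hg, ?_⟩
  · have e1 := Finset.sum_powerset_apply_card (fun m => (φ m).natAbs * 4)
      (x := (Finset.univ : Finset (Fin d)))
    rw [Finset.powerset_univ] at e1
    rw [e1]
    simp only [Finset.card_univ, Fintype.card_fin, smul_eq_mul]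
    have e2 : ∀ m ∈ Finset.range (d + 1), (φ m).natAbs * 4 ≤
        (if m ≤ D then 1 else 0) * ((M * 2 ^ D + 1) * 4) := by
      intro m hm
      have hmd : m ≤ d := by simpa [Nat.lt_succ_iff] using hm
      by_cases h : m ≤ D
      · have h5 := hφ m
        simp only [h, if_true, mul_one, one_mul] at h5 ⊢
        apply Nat.mul_le_mul_right
        have h6 : |a m| ≤ 2 ^ D := (ha3 m (fun t ht => hbd1 t (ht.trans hmd))).trans
          (pow_le_pow_right₀ (by norm_num) h)
        have h7 : |(φ m : ℝ)| ≤ M * 2 ^ D + 1 := by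
          have : |(φ m : ℝ)| ≤ |(φ m : ℝ) - M * a m| + |M * a m| := by
            have := abs_add_le ((φ m : ℝ) - M * a m) (M * a m)
            simpa using this
          rw [abs_mul, Nat.abs_cast] at this
          have h8 : (M : ℝ) * |a m| ≤ M * 2 ^ D := mul_le_mul_of_nonneg_left h6 (by positivity)
          linarith
        have h9 : (((φ m).natAbs : ℕ) : ℝ) = |(φ m : ℝ)| := by
          rw [Nat.cast_natAbs, Int.cast_abs]
        rw [← h9] at h7
        exact_mod_cast h7
      · simp [φ, h]
    calc _ ≤ ∑ m ∈ Finset.range (d + 1),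
          (d.choose m * (if m ≤ D then 1 else 0)) * ((M * 2 ^ D + 1) * 4) := by
          refine Finset.sum_le_sum fun m hm => ?_
          rw [mul_assoc]
          exact Nat.mul_le_mul_left _ (e2 m hm)
      _ ≤ S * ((M * 2 ^ D + 1) * 4) := by
          rw [← Finset.sum_mul]
          exact Nat.mul_le_mul_right _ (indicator_sum_le d D d le_rfl)
      _ ≤ S * ((2 * S * S * E * 2 ^ D + S * S * E * 2 ^ D) * 4) := by
          apply Nat.mul_le_mul_left
          apply Nat.mul_le_mul_right
          apply Nat.add_le_add
          · apply Nat.mul_le_mul_right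
            rw [hM]
            apply Nat.mul_le_mul_right
            calc S * (d + 2) ≤ S * (2 * S) := Nat.mul_le_mul_left _ (by omega)
              _ = _ := by ring
          · have : 0 < S := by omega
            have : 0 < S * S * E * 2 ^ D := by positivity
            omega
      _ = _ := by ring
  · have hM1 : (1 : ℝ) / ε ≤ E := Nat.le_ceil _
    have hM2 : E ≤ M := by
      rw [hM]; exact Nat.le_mul_of_pos_left _ (Nat.mul_pos (by omega) (by omega))
    have hM3 : (E : ℝ) ≤ M := by exact_mod_cast hM2
    have : (0 : ℝ) < E := by exact_mod_cast hE1
    linarith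
  · intro x y
    obtain ⟨t, ht, ht1, ht2⟩ := subset_sum d φ x y
    rw [ht1, hfg, ht2]
    have hv := hval t ht
    constructor
    · intro h
      have : t = 0 := by exact_mod_cast h
      subst this
      have hφ0 : φ 0 = M := by
        have := ha2 0
        simp [hp0] at this
        simp [φ, ← this]
      simp [hφ0]
    · intro h
      have ht' : 1 ≤ t := by exact_mod_cast h
      have hp' := hpt t ht' ht
      set Q : ℤ := ∑ m ∈ Finset.range (t + 1), (t.choose m : ℤ) * φ m with hQ
      have q1 : |(Q : ℝ)| ≤ S / 2 + M * (ε * (1 - 1 / (2 * ((d : ℝ) + 2)))) := by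
        have := abs_add_le ((Q : ℝ) - M * p.eval (t : ℝ)) (M * p.eval (t : ℝ))
        rw [sub_add_cancel, abs_mul (M : ℝ), Nat.abs_cast] at this
        have := mul_le_mul_of_nonneg_left hp' (Nat.cast_nonneg (α := ℝ) M)
        linarith
      have q2 : (S : ℝ) / 2 ≤ M * (ε * (1 / (2 * ((d : ℝ) + 2)))) := by
        have : (M : ℝ) * (ε * (1 / (2 * ((d : ℝ) + 2)))) = S / 2 * (E * ε) := by
          rw [hM]; push_cast; field_simp
        rw [this]
        exact le_mul_of_one_le_right (by positivity) hEε
      push_cast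
      rw [abs_mul, abs_of_pos (by norm_num : (0 : ℝ) < 4)]
      nlinarith


/-- Reduction from Orthogonal Vectors to approximating
`{−1,1}`-Max-IP via the `O(√(d·log(1/ε)))`-degree approximate polynomial for OR:
there is a universal constant `c₁ ≥ 1` such that for every `d > 0` and `ε ∈ (0,1)`,
with `D = ⌈c₁·√(d·log₂(1/ε))⌉`, there are `d₁ ≤ (∑_{k≤D} C(d,k))³·2^D·⌈1/ε⌉·c₁`,
a real `T > 1/ε`, and maps `f, g : {0,1}^d → {−1,1}^{d₁}` such that `x·y = 0` implies
`f(x)·g(y) ≥ T`, while `x·y ≥ 1` implies `|f(x)·g(y)| ≤ ε·T`. -/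
theorem OV_to_pm1_MaxIP_reduction :
    ∃ c₁ : ℕ, 1 ≤ c₁ ∧
      ∀ d : ℕ, 0 < d → ∀ ε : ℝ, 0 < ε → ε < 1 →
        ∃ d₁ : ℕ,
          d₁ ≤ (∑ k ∈ Finset.range (⌈(c₁ : ℝ) * Real.sqrt (d * Real.logb 2 (1 / ε))⌉₊ + 1),
                  d.choose k) ^ 3 *
                2 ^ ⌈(c₁ : ℝ) * Real.sqrt (d * Real.logb 2 (1 / ε))⌉₊ * ⌈1 / ε⌉₊ * c₁ ∧
          ∃ T : ℝ, 1 / ε < T ∧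
          ∃ f g : (Fin d → Bool) → (Fin d₁ → ℤ),
            (∀ x i, f x i = 1 ∨ f x i = -1) ∧
            (∀ y i, g y i = 1 ∨ g y i = -1) ∧
            (∀ x y : Fin d → Bool,
              ((∑ i, ((x i).toNat : ℤ) * ((y i).toNat : ℤ)) = 0 →
                T ≤ ((∑ i, f x i * g y i : ℤ) : ℝ)) ∧
              (1 ≤ (∑ i, ((x i).toNat : ℤ) * ((y i).toNat : ℤ)) →
                (|(∑ i, f x i * g y i : ℤ)| : ℝ) ≤ ε * T)) := by
  refine ⟨12, by norm_num, fun d hd ε h0 h1 => ?_⟩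
  obtain ⟨p, p1, p2, p3⟩ := approx_poly d hd ε h0 h1
  have hL : 0 < Real.logb 2 (1 / ε) :=
    Real.logb_pos (by norm_num) (by rw [lt_div_iff₀ h0]; linarith)
  have hd' : (0 : ℝ) < d := by exact_mod_cast hd
  exact reduction d _ (Nat.ceil_pos.mpr (by positivity)) ε h0 h1 p p1 p2 p3
end
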